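/- Let M be a finitely generated conical refinement monoid such that for every free prime p of M which is not minimal in the poset of primes of M, the unique group homomorphism G(φ_p) : G(M_{J_p}) → G'_p satisfying G(φ_p) ∘ ι = φ_p (for a Grothendieck group ι : M_{J_p} → G(M_{J_p})) is surjective with kernel equal to the cyclic subgroup of G(M_{J_p}) generated by ι(x) for some x ∈ M_{J_p}. Then there exists a countable row-finite directed graph E such that M ≅ M(E). -/

import Mathlib

namespace ArPardo

/-- A countable row-finite directed graph `E = (E⁰, E¹, s, r)`. -/
structure RowFiniteGraph : Type 1 where
  V : Type
  E : Type
  countableV : Countable V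
  countableE : Countable E
  s : E → V
  r : E → V
  rowFinite : ∀ v : V, {e : E | s e = v}.Finite

/-- The defining relations of the graph monoid, as a relation on the free
commutative monoid `V →₀ ℕ` on the vertices: for every vertex `v` emitting
at least one edge, `a_v = Σ_{e ∈ s⁻¹(v)} a_{r(e)}`. -/
def graphRel (G : RowFiniteGraph) (x y : G.V →₀ ℕ) : Prop :=
  ∃ v : G.V, (∃ e : G.E, G.s e = v) ∧ x = Finsupp.single v 1 ∧
    y = ∑ e ∈ (G.rowFinite v).toFinset, Finsupp.single (G.r e) 1

/-- The graph monoid `M(E)`: the quotient of the free commutative monoid on the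
vertices by the congruence generated by the graph relations. -/
def graphMonoid (G : RowFiniteGraph) : Type :=
  (addConGen (graphRel G)).Quotient

noncomputable instance (G : RowFiniteGraph) : AddCommMonoid (graphMonoid G) :=
  inferInstanceAs (AddCommMonoid (addConGen (graphRel G)).Quotient)

/-- The canonical generator `a_v` of the graph monoid. -/
noncomputable def vertexElem (G : RowFiniteGraph) (v : G.V) : graphMonoid G :=
  (addConGen (graphRel G)).mk' (Finsupp.single v 1)

/-- A commutative monoid is a graph monoid if it is isomorphic to `M(E)` for some
(countable) row-finite directed graph `E`. -/
def IsGraphMonoid (M : Type) [AddCommMonoid M] : Prop :=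
  ∃ G : RowFiniteGraph, Nonempty (M ≃+ graphMonoid G)

/-- The algebraic preorder on a commutative monoid: `x ≤ y` iff `y = x + z`. -/
def algLE {M : Type} [AddCommMonoid M] (x y : M) : Prop :=
  ∃ z : M, y = x + z

/-- A commutative monoid is conical if `x + y = 0` implies `x = y = 0`. -/
def IsConical (M : Type) [AddCommMonoid M] : Prop :=
  ∀ x y : M, x + y = 0 → x = 0 ∧ y = 0

/-- The Riesz refinement property. -/
def IsRefinement (M : Type) [AddCommMonoid M] : Prop :=
  ∀ a b c d : M, a + b = c + d →
    ∃ w x y z : M, a = w + x ∧ b = y + z ∧ c = w + y ∧ d = x + z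

/-- A prime element: not invertible, and `p ≤ a + b` implies `p ≤ a` or `p ≤ b`. -/
def IsPrimeElem {M : Type} [AddCommMonoid M] (p : M) : Prop :=
  (∀ q : M, p + q ≠ 0) ∧ ∀ a b : M, algLE p (a + b) → algLE p a ∨ algLE p b

/-- A free element: `n • p ≤ m • p` implies `n ≤ m`. -/
def IsFreeElem {M : Type} [AddCommMonoid M] (p : M) : Prop :=
  ∀ n m : ℕ, algLE (n • p) (m • p) → n ≤ m

/-- A regular element: `2x ≤ x`. -/
def IsRegularElem {M : Type} [AddCommMonoid M] (x : M) : Prop :=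
  algLE (x + x) x

/-- `q̄ < p̄` in the poset of (classes of) elements: `q ≤ p` and `p ≰ q`. -/
def classLT {M : Type} [AddCommMonoid M] (q p : M) : Prop :=
  algLE q p ∧ ¬ algLE p q

/-- `q` is a prime whose class lies in the lower cover of the class of the prime `p`:
`q̄ < p̄` and no prime class lies strictly between. -/
def InLowerCover {M : Type} [AddCommMonoid M] (p q : M) : Prop :=
  IsPrimeElem q ∧ classLT q p ∧
    ¬ ∃ t : M, IsPrimeElem t ∧ classLT q t ∧ classLT t p

/-- `Q` is a (finite) set of representatives of the classes in the lower cover of `p̄`: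
its elements are in the lower cover, pairwise inequivalent, and every prime in the
lower cover is equivalent to one of them. -/
def IsLowerCoverReps {M : Type} [AddCommMonoid M] (p : M) (Q : Finset M) : Prop :=
  (∀ q ∈ Q, InLowerCover p q) ∧
  (∀ q ∈ Q, ∀ q' ∈ Q, algLE q q' → algLE q' q → q = q') ∧
  (∀ t : M, InLowerCover p t → ∃ q ∈ Q, algLE q t ∧ algLE t q)

/-- The underlying set of the group `G'_p = {p + α : α ∈ M, p + α ≤ p}`. -/
def GpSet {M : Type} [AddCommMonoid M] (p : M) : Set M :=
  {y | ∃ α : M, y = p + α ∧ algLE y p}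

/-- `j : G' → M` realizes the abelian group `G'` as the group
`G'_p = {p + α : p + α ≤ p}` with identity `p` and operation
`(p + α) ∘ (p + β) = p + (α + β)`. -/
structure GpStructure (M : Type) [AddCommMonoid M] (p : M)
    (G' : Type) [AddCommGroup G'] (j : G' → M) : Prop where
  inj : Function.Injective j
  range_eq : Set.range j = GpSet p
  map_zero : j 0 = p
  map_add : ∀ (u v : G') (α β : M), j u = p + α → j v = p + β → j (u + v) = p + (α + β)

/-- The archimedean component of `s`: all `a` with `a ≤ n • s` and `s ≤ m • a` for
some positive integers `n, m`; it is a subsemigroup. -/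
def archComp {M : Type} [AddCommMonoid M] (s : M) : AddSubsemigroup M where
  carrier := {a : M | ∃ n m : ℕ, 0 < n ∧ 0 < m ∧ algLE a (n • s) ∧ algLE s (m • a)}
  add_mem' := by
    rintro a b ⟨n, m, hn, hm, ⟨z, hz⟩, ⟨w, hw⟩⟩ ⟨n', m', hn', hm', ⟨z', hz'⟩, ⟨w', hw'⟩⟩
    refine ⟨n + n', m, Nat.add_pos_left hn _, hm, ⟨z + z', ?_⟩, ⟨w + m • b, ?_⟩⟩
    · rw [add_nsmul, hz, hz']; abel
    · rw [nsmul_add, hw]; abel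

/-- `(Γ, ι)` is a Grothendieck group of the commutative semigroup `S`: every
semigroup homomorphism from `S` to an abelian group factors uniquely through `ι`. -/
def IsGrothendieck (S : Type) [Add S] (Γ : Type) [AddCommGroup Γ] (ι : AddHom S Γ) : Prop :=
  ∀ (A : Type) [AddCommGroup A], ∀ f : AddHom S A, ∃! g : Γ →+ A, ∀ x : S, g (ι x) = f x

/-- The almost-isomorphism condition at a free prime `p`, with `Q` a set of
representatives of the lower cover of `p̄`, and `s_p = Σ_{q ∈ Q} q`: for every
Grothendieck group `ι : M_{J_p} → Γ` of the archimedean component `M_{J_p}` of `s_p`,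
every realization `(G', j)` of the group `G'_p`, every incarnation
`φp : M_{J_p} → G'` of the map `x ↦ p + x`, the unique group homomorphism
`ψ = G(φ_p) : Γ → G'` with `ψ ∘ ι = φp` is surjective and its kernel is the cyclic
subgroup generated by `ι x` for some `x ∈ M_{J_p}`. -/
def AlmostIsoCondition (M : Type) [AddCommMonoid M] (p : M) (Q : Finset M) : Prop :=
  ∀ (Γ : Type) [AddCommGroup Γ],
    ∀ ι : AddHom (archComp (∑ q ∈ Q, (q : M))) Γ,
    IsGrothendieck (archComp (∑ q ∈ Q, (q : M))) Γ ι →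
    ∀ (G' : Type) [AddCommGroup G'], ∀ j : G' → M, GpStructure M p G' j →
    ∀ φp : AddHom (archComp (∑ q ∈ Q, (q : M))) G',
      (∀ a : archComp (∑ q ∈ Q, (q : M)), j (φp a) = p + (a : M)) →
    ∀ ψ : Γ →+ G', (∀ a, ψ (ι a) = φp a) →
      Function.Surjective ψ ∧
        ∃ x : archComp (∑ q ∈ Q, (q : M)), ψ.ker = AddSubgroup.zmultiples (ι x)

/-- An order-ideal of a commutative monoid. -/
def IsOrderIdeal {M : Type} [AddCommMonoid M] (S : Set M) : Prop :=
  (0 : M) ∈ S ∧ (∀ x y : M, x ∈ S → y ∈ S → x + y ∈ S) ∧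
    ∀ x y : M, algLE x y → y ∈ S → x ∈ S

/-- The order-ideal generated by a subset: the smallest order-ideal containing it. -/
def orderIdealGen {M : Type} [AddCommMonoid M] (X : Set M) : Set M :=
  ⋂₀ {S : Set M | IsOrderIdeal S ∧ X ⊆ S}

/-- The restriction graph `E_H` of a hereditary subset `H` of the vertices. -/
def restrictGraph (G : RowFiniteGraph) (H : Set G.V)
    (hher : ∀ e : G.E, G.s e ∈ H → G.r e ∈ H) : RowFiniteGraph where
  V := ↥H
  E := {e : G.E // G.s e ∈ H}
  countableV := by have := G.countableV; exact inferInstance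
  countableE := by have := G.countableE; exact inferInstance
  s := fun e => ⟨G.s e.1, e.2⟩
  r := fun e => ⟨G.r e.1, hher e.1 e.2⟩
  rowFinite := fun v => by
    have hsub : {e : {e : G.E // G.s e ∈ H} | (⟨G.s e.1, e.2⟩ : ↥H) = v}
        ⊆ Subtype.val ⁻¹' {e : G.E | G.s e = (v : G.V)} := by
      intro e he
      simpa [Subtype.ext_iff] using he
    exact Set.Finite.subset
      (Set.Finite.preimage (Subtype.val_injective.injOn) (G.rowFinite (v : G.V))) hsub

section AlgLE

variable {M : Type} [AddCommMonoid M]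

theorem algLE.refl (x : M) : algLE x x := ⟨0, by simp⟩

theorem algLE.trans {x y z : M} : algLE x y → algLE y z → algLE x z := by
  rintro ⟨a, rfl⟩ ⟨b, rfl⟩
  exact ⟨a + b, add_assoc _ _ _⟩

theorem algLE.add {a b c d : M} : algLE a b → algLE c d → algLE (a + c) (b + d) := by
  rintro ⟨x, rfl⟩ ⟨y, rfl⟩
  exact ⟨x + y, add_add_add_comm _ _ _ _⟩

theorem algLE_self_add (x y : M) : algLE x (x + y) := ⟨y, rfl⟩

theorem algLE_add_self (x y : M) : algLE y (x + y) := ⟨x, add_comm _ _⟩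

theorem zero_algLE (x : M) : algLE 0 x := ⟨x, (zero_add x).symm⟩

theorem algLE_sum_of_mem {ι : Type*} {s : Finset ι} (f : ι → M) {i : ι} (hi : i ∈ s) :
    algLE (f i) (∑ j ∈ s, f j) := by
  classical
  rw [← Finset.add_sum_erase s f hi]
  exact algLE_self_add _ _

theorem algLE.nsmul {x y : M} (h : algLE x y) (n : ℕ) : algLE (n • x) (n • y) := by
  obtain ⟨z, rfl⟩ := h
  exact ⟨n • z, nsmul_add _ _ _⟩

theorem nsmul_algLE_nsmul {m n : ℕ} (h : m ≤ n) (x : M) : algLE (m • x) (n • x) := by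
  obtain ⟨k, rfl⟩ := Nat.exists_eq_add_of_le h
  exact ⟨k • x, add_nsmul _ _ _⟩

theorem algLE.trans_classLT {x y z : M} (h : algLE x y) (h' : classLT y z) : classLT x z :=
  ⟨h.trans h'.1, fun h'' => h'.2 (h''.trans h)⟩

namespace IsPrimeElem

variable {p : M}

theorem not_algLE_zero (hp : IsPrimeElem p) : ¬ algLE p 0 := fun ⟨z, hz⟩ => hp.1 z hz.symm

theorem of_equiv {q : M} (hp : IsPrimeElem p) (hpq : algLE p q) (hqp : algLE q p) :
    IsPrimeElem q := by
  refine ⟨fun z hz => hp.not_algLE_zero (hpq.trans ⟨z, hz.symm⟩), fun a b h => ?_⟩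
  exact (hp.2 a b (hpq.trans h)).imp hqp.trans hqp.trans

theorem exists_algLE_of_algLE_sum (hp : IsPrimeElem p) {ι : Type*} (s : Finset ι) (f : ι → M)
    (h : algLE p (∑ i ∈ s, f i)) : ∃ i ∈ s, algLE p (f i) := by
  classical
  induction s using Finset.induction_on with
  | empty => exact absurd h hp.not_algLE_zero
  | insert i s hi ih =>
    rw [Finset.sum_insert hi] at h
    rcases hp.2 _ _ h with h | h
    · exact ⟨i, Finset.mem_insert_self _ _, h⟩
    · obtain ⟨j, hj, hpj⟩ := ih h
      exact ⟨j, Finset.mem_insert_of_mem hj, hpj⟩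

theorem algLE_of_algLE_nsmul (hp : IsPrimeElem p) {n : ℕ} {x : M} (h : algLE p (n • x)) :
    algLE p x := by
  rw [← Finset.card_range n, ← Finset.sum_const] at h
  obtain ⟨_, _, h⟩ := hp.exists_algLE_of_algLE_sum _ _ h
  exact h

theorem exists_algLE_of_algLE_linearCombination (hp : IsPrimeElem p) {V : Type*} {val : V → M}
    {b : V →₀ ℕ} (h : algLE p (Finsupp.linearCombination ℕ val b)) :
    ∃ u ∈ b.support, algLE p (val u) := by
  rw [Finsupp.linearCombination_apply] at h
  obtain ⟨u, hu, h⟩ := hp.exists_algLE_of_algLE_sum _ _ h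
  exact ⟨u, hu, hp.algLE_of_algLE_nsmul h⟩

/-- Strictly smaller elements are absorbed by a prime. -/
theorem add_algLE_self (hp : IsPrimeElem p) {q : M} (h : classLT q p) : algLE (p + q) p := by
  obtain ⟨⟨z, hz⟩, hn⟩ := h
  rcases hp.2 q z ⟨0, by rw [← hz, add_zero]⟩ with h | ⟨d, rfl⟩
  · exact absurd h hn
  · exact ⟨d, hz.trans (by abel)⟩

theorem nsmul_algLE_of_not_algLE (hp : IsPrimeElem p) (href : IsRefinement M) (k : ℕ) :
    ∀ {y t : M}, ¬ algLE p y → algLE (k • p) (y + t) → algLE (k • p) t := by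
  induction k with
  | zero => intro y t _ _; simpa using zero_algLE t
  | succ k ih =>
    rintro y t hy ⟨r, hr⟩
    have hr' : y + t = p + (k • p + r) := by rw [hr, succ_nsmul]; abel
    obtain ⟨w, x, y', t', rfl, rfl, hpw, hk⟩ := href _ _ _ _ hr'
    have hx : algLE p y' := by
      rcases hp.2 w y' ⟨0, by rw [add_zero, hpw]⟩ with h | h
      · exact absurd (h.trans (algLE_self_add _ _)) hy
      · exact h
    have := ih (y := x) (t := t') (fun h => hy (h.trans (algLE_add_self _ _))) ⟨r, hk.symm⟩
    rw [succ_nsmul, add_comm]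
    exact hx.add this

theorem isRegularElem_of_succ_nsmul_algLE (hp : IsPrimeElem p) (href : IsRefinement M) (m : ℕ)
    (h : algLE ((m + 1) • p) (m • p)) : IsRegularElem p := by
  induction m with
  | zero => exact absurd (by simpa using h) hp.not_algLE_zero
  | succ m ih =>
    by_contra hreg
    obtain ⟨z, hz⟩ := h
    have hz' : p + ((m + 1) • p + z) = p + m • p := by
      rw [succ_nsmul' p m] at hz
      rw [hz, succ_nsmul' p (m + 1)]; abel
    obtain ⟨w, x, y, t, hw, hy, hp', hm⟩ := href _ _ _ _ hz'
    apply hreg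
    by_cases hpy : algLE p y
    · by_cases hpw : algLE p w
      · rw [IsRegularElem]
        nth_rewrite 3 [hp']
        exact hpw.add hpy
      · have hpx : algLE p x := (hp.2 w x ⟨0, by rw [add_zero, hw]⟩).resolve_left hpw
        refine ih (algLE.trans ⟨z, hy.symm⟩ ?_)
        rw [hm]
        refine algLE.add (algLE.trans ?_ hpx) (algLE.refl _)
        rw [hp']; exact algLE_add_self _ _
    · refine ih ((hp.nsmul_algLE_of_not_algLE href (m + 1) hpy ⟨z, hy.symm⟩).trans ?_)
      rw [hm]; exact algLE_add_self _ _

theorem isFreeElem_or_isRegularElem (hp : IsPrimeElem p) (href : IsRefinement M) :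
    IsFreeElem p ∨ IsRegularElem p := by
  by_contra! h
  obtain ⟨hf, hr⟩ := h
  simp only [IsFreeElem, not_forall, not_le] at hf
  obtain ⟨n, m, hnm, hlt⟩ := hf
  exact hr (hp.isRegularElem_of_succ_nsmul_algLE href m ((nsmul_algLE_nsmul hlt p).trans hnm))

end IsPrimeElem

theorem IsFreeElem.not_isRegularElem {p : M} (hf : IsFreeElem p) : ¬ IsRegularElem p := by
  intro h
  have := hf 2 1 (by rwa [two_nsmul, one_nsmul])
  omega

theorem exists_surjective_linearCombination (M : Type) [AddCommMonoid M] [AddMonoid.FG M] :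
    ∃ S : Finset M, Function.Surjective (Finsupp.linearCombination ℕ (fun s : S => (s : M))) := by
  obtain ⟨S, hS⟩ := (AddMonoid.fg_def (M := M)).1 inferInstance
  refine ⟨S, ?_⟩
  rw [← LinearMap.range_eq_top, Finsupp.range_linearCombination]
  apply Submodule.toAddSubmonoid_injective
  simpa [Submodule.span_nat_eq_addSubmonoidClosure] using hS

theorem wellFounded_classLT [AddMonoid.FG M] : WellFounded (classLT : M → M → Prop) := by
  obtain ⟨S, hsurj⟩ := exists_surjective_linearCombination M
  have hwqo : WellQuasiOrdered (algLE : M → M → Prop) := by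
    intro f
    choose g hg using hsurj
    obtain ⟨i, j, hij, hle⟩ := wellQuasiOrdered_le (α := S →₀ ℕ) (fun n => g (f n))
    refine ⟨i, j, hij, ?_⟩
    rw [← hg (f i), ← hg (f j)]
    obtain ⟨c, hc⟩ := exists_add_of_le hle
    exact ⟨Finsupp.linearCombination ℕ (fun s : S => (s : M)) c, by rw [hc, map_add]⟩
  have : IsPreorder M algLE := { refl := algLE.refl, trans := fun _ _ _ => algLE.trans }
  exact hwqo.wellFounded

/-- A submonoid that contains a prime whenever it contains everything strictly below it is the
whole monoid. -/
theorem eq_top_of_isPrimeElem_mem [AddMonoid.FG M] (hcon : IsConical M) (href : IsRefinement M)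
    (K : AddSubmonoid M)
    (hK : ∀ p, IsPrimeElem p → (∀ x, classLT x p → x ∈ K) → p ∈ K) : K = ⊤ := by
  rw [eq_top_iff]
  rintro a -
  refine wellFounded_classLT.induction (C := fun a => a ∈ K) a fun a ih => ?_
  by_cases ha : a = 0
  · rw [ha]; exact zero_mem _
  by_cases h : ∃ b c, a = b + c ∧ classLT b a ∧ classLT c a
  · obtain ⟨b, c, rfl, hb, hc⟩ := h
    exact add_mem (ih b hb) (ih c hc)
  · refine hK a ⟨fun q hq => ha (hcon a q hq).1, ?_⟩ ih
    rintro b c ⟨z, hz⟩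
    obtain ⟨b', c', x, y, rfl, rfl, rfl, -⟩ := href _ _ _ _ hz
    by_contra! hn
    exact h ⟨b', x, rfl,
      ⟨algLE_self_add _ _, fun h => hn.1 (h.trans (algLE_self_add _ _))⟩,
      ⟨algLE_add_self _ _, fun h => hn.2 (h.trans (algLE_self_add _ _))⟩⟩

theorem closure_setOf_isPrimeElem [AddMonoid.FG M] (hcon : IsConical M) (href : IsRefinement M) :
    AddSubmonoid.closure {p : M | IsPrimeElem p} = ⊤ :=
  eq_top_of_isPrimeElem_mem hcon href _ fun _ hp _ => AddSubmonoid.subset_closure hp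

theorem eq_zero_of_forall_isPrimeElem_not_algLE [AddMonoid.FG M] (hcon : IsConical M)
    (href : IsRefinement M) {x : M} (h : ∀ p, IsPrimeElem p → ¬ algLE p x) : x = 0 := by
  have hx : x ∈ AddSubmonoid.closure {p : M | IsPrimeElem p} := by
    rw [closure_setOf_isPrimeElem hcon href]; trivial
  induction hx using AddSubmonoid.closure_induction with
  | mem x hx => exact absurd (algLE.refl x) (h x hx)
  | zero => rfl
  | add x y _ _ hx hy =>
    rw [hx fun p hp h' => h p hp (h'.trans (algLE_self_add _ _)),
      hy fun p hp h' => h p hp (h'.trans (algLE_add_self _ _)), add_zero]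

theorem exists_prime_representatives (M : Type) [AddCommMonoid M] [AddMonoid.FG M] :
    ∃ C : Finset M, (∀ p ∈ C, IsPrimeElem p) ∧
      (∀ p ∈ C, ∀ q ∈ C, algLE p q → algLE q p → p = q) ∧
      ∀ p : M, IsPrimeElem p → ∃ c ∈ C, algLE c p ∧ algLE p c := by
  classical
  obtain ⟨S, hS⟩ := (AddMonoid.fg_def (M := M)).1 inferInstance
  let E : Setoid M :=
    ⟨fun x y => algLE x y ∧ algLE y x, fun x => ⟨algLE.refl x, algLE.refl x⟩, fun h => h.symm,
      fun h h' => ⟨h.1.trans h'.1, h'.2.trans h.2⟩⟩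
  let rep : M → M := fun x => (Quotient.mk E x).out
  have hrep : ∀ x, algLE (rep x) x ∧ algLE x (rep x) := fun x => Quotient.mk_out (s := E) x
  refine ⟨(S.filter IsPrimeElem).image rep, ?_, ?_, ?_⟩
  · simp only [Finset.mem_image, Finset.mem_filter]
    rintro _ ⟨x, ⟨-, hx⟩, rfl⟩
    exact hx.of_equiv (hrep x).2 (hrep x).1
  · simp only [Finset.mem_image, Finset.mem_filter]
    rintro _ ⟨x, -, rfl⟩ _ ⟨y, -, rfl⟩ h h'
    have : Quotient.mk E x = Quotient.mk E y := Quotient.sound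
      ⟨((hrep x).2.trans h).trans (hrep y).1, ((hrep y).2.trans h').trans (hrep x).1⟩
    simp only [rep, this]
  · intro p hp
    have key : ∀ x ∈ AddSubmonoid.closure (S : Set M), algLE p x →
        ∃ s ∈ S, algLE p s ∧ algLE s x := by
      intro x hx
      induction hx using AddSubmonoid.closure_induction with
      | mem x hx => exact fun h => ⟨x, hx, h, algLE.refl x⟩
      | zero => exact fun h => absurd h hp.not_algLE_zero
      | add x y _ _ hx hy =>
        intro h
        rcases hp.2 _ _ h with h | h
        · obtain ⟨s, hs, h1, h2⟩ := hx h
          exact ⟨s, hs, h1, h2.trans (algLE_self_add _ _)⟩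
        · obtain ⟨s, hs, h1, h2⟩ := hy h
          exact ⟨s, hs, h1, h2.trans (algLE_add_self _ _)⟩
    obtain ⟨s, hs, h1, h2⟩ := key p (by rw [hS]; trivial) (algLE.refl p)
    refine ⟨rep s, Finset.mem_image_of_mem _ (Finset.mem_filter.2 ⟨hs, hp.of_equiv h1 h2⟩), ?_⟩
    exact ⟨(hrep s).1.trans h2, h1.trans (hrep s).2⟩

end AlgLE

section AlmostIso

theorem exists_isGrothendieck (S : Type) [AddCommSemigroup S] :
    ∃ (Γ : Type) (_ : AddCommGroup Γ) (ι : AddHom S Γ), IsGrothendieck S Γ ι ∧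
      ∀ a b, ι a = ι b → ∃ c : S, a + c = b + c := by
  refine ⟨Algebra.GrothendieckAddGroup (WithZero S), inferInstance,
    (Algebra.GrothendieckAddGroup.of (M := WithZero S) : AddHom (WithZero S) _).comp
      WithZero.coeAddHom, ?_, ?_⟩
  · intro A _ f
    refine ⟨Algebra.GrothendieckAddGroup.lift (WithZero.lift f), fun x => ?_, fun g hg => ?_⟩
    · exact (DFunLike.congr_fun (Algebra.GrothendieckAddGroup.lift.symm_apply_apply
        (WithZero.lift f)) (x : WithZero S)).trans (WithZero.lift_coe f x)
    · rw [← Equiv.symm_apply_eq]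
      rw [← Equiv.symm_apply_eq]
      ext x
      exact hg x
  · intro a b hab
    obtain ⟨c, hc⟩ :=
      (AddLocalization.addMonoidOf (⊤ : AddSubmonoid (WithZero S))).eq_iff_exists.1 hab
    obtain ⟨c, _⟩ := c
    induction c using WithZero.recZeroCoe with
    | zero =>
      refine ⟨a, ?_⟩
      have : a = b := WithZero.coe_injective (by simpa using hc)
      rw [this]
    | coe c =>
      refine ⟨c, ?_⟩
      rw [add_comm a, add_comm b]
      exact WithZero.coe_injective hc

variable {M : Type} [AddCommMonoid M]

/-- The elements absorbed by `p` up to equivalence. -/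
def absorbed (p : M) : AddSubmonoid M where
  carrier := {α | algLE (p + α) p}
  zero_mem' := by simpa using algLE.refl p
  add_mem' := by
    intro a b ha hb
    have := (algLE.add ha (algLE.refl b)).trans hb
    rwa [add_assoc] at this

/-- The congruence on `absorbed p` whose quotient is `G'_p`. -/
def absorbedCon (p : M) : AddCon (absorbed p) where
  r a b := p + (a : M) = p + b
  iseqv := ⟨fun _ => rfl, fun h => h.symm, fun h h' => h.trans h'⟩
  add' := by
    intro a b c d h h'
    change p + ((a : M) + c) = p + ((b : M) + d)
    rw [← add_assoc, h, add_right_comm, h', add_right_comm, add_assoc]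

theorem absorbedCon_exists_neg (p : M) (u : (absorbedCon p).Quotient) :
    ∃ v : (absorbedCon p).Quotient, v + u = 0 := by
  induction u using AddCon.induction_on with
  | H a =>
    obtain ⟨a, z, hz⟩ := a
    have hz' : p + (z + a) = p := by rw [add_comm z, ← add_assoc]; exact hz.symm
    refine ⟨((⟨z, a, ?_⟩ : absorbed p) : (absorbedCon p).Quotient), ?_⟩
    · rw [add_assoc, hz']
    · refine (AddCon.eq _).2 ?_
      change p + (z + a) = p + 0
      rw [hz', add_zero]

noncomputable instance (p : M) : Neg (absorbedCon p).Quotient :=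
  ⟨fun u => (absorbedCon_exists_neg p u).choose⟩

noncomputable instance (p : M) : AddCommGroup (absorbedCon p).Quotient :=
  { (inferInstance : AddCommMonoid (absorbedCon p).Quotient) with
    zsmul := zsmulRec
    neg_add_cancel := fun u => (absorbedCon_exists_neg p u).choose_spec }

/-- The embedding of `G'_p` into `M`. -/
def absorbedVal (p : M) : (absorbedCon p).Quotient → M :=
  Quotient.lift (fun a : absorbed p => p + (a : M)) fun _ _ h => h

theorem gpStructure_absorbedVal (p : M) :
    GpStructure M p (absorbedCon p).Quotient (absorbedVal p) where
  inj := by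
    intro u v h
    induction u, v using AddCon.induction_on₂ with
    | H a b => exact (AddCon.eq _).2 h
  range_eq := by
    ext y
    constructor
    · rintro ⟨u, rfl⟩
      induction u using AddCon.induction_on with
      | H a => exact ⟨a, rfl, a.2⟩
    · rintro ⟨α, rfl, h⟩
      exact ⟨((⟨α, h⟩ : absorbed p) : (absorbedCon p).Quotient), rfl⟩
  map_zero := add_zero p
  map_add := by
    intro u v α β hu hv
    induction u, v using AddCon.induction_on₂ with
    | H a b =>
      change p + (a : M) = p + α at hu
      change p + (b : M) = p + β at hv
      change p + ((a : M) + b) = p + (α + β)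
      rw [← add_assoc, hu, add_right_comm, hv, add_right_comm, add_assoc]

theorem archComp_le_absorbed {p s : M} (hs : s ∈ absorbed p) {a : M} (ha : a ∈ archComp s) :
    a ∈ absorbed p := by
  obtain ⟨n, -, -, -, h, -⟩ := ha
  exact ((algLE.refl p).add h).trans (nsmul_mem hs n)

theorem AlmostIsoCondition.exists_generator {p : M} {Q : Finset M}
    (h : AlmostIsoCondition M p Q) (hQ : ∑ q ∈ Q, q ∈ absorbed p) :
    ∃ x ∈ archComp (∑ q ∈ Q, q), p + x = p ∧
      ∀ β ∈ archComp (∑ q ∈ Q, q), p + β = p → ∃ n m : ℕ, β + n • x = m • x := by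
  obtain ⟨Γ, _, ι, hι, hι'⟩ := exists_isGrothendieck (archComp (∑ q ∈ Q, q))
  let φ : AddHom (archComp (∑ q ∈ Q, q)) (absorbedCon p).Quotient :=
    { toFun := fun a => ((⟨a, archComp_le_absorbed hQ a.2⟩ : absorbed p) : (absorbedCon p).Quotient)
      map_add' := fun _ _ => rfl }
  obtain ⟨ψ, hψ, -⟩ := hι _ φ
  obtain ⟨-, x, hx⟩ := h Γ ι hι _ _ (gpStructure_absorbedVal p) φ (fun _ => rfl) ψ hψ
  have hker : ∀ a, ι a ∈ ψ.ker ↔ p + (a : M) = p := by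
    intro a
    rw [AddMonoidHom.mem_ker, hψ]
    refine (AddCon.eq _).trans ?_
    change p + (a : M) = p + 0 ↔ _
    rw [add_zero]
  refine ⟨x, x.2, (hker x).1 (hx ▸ AddSubgroup.mem_zmultiples _), fun β hβ hpβ => ?_⟩
  have hmem : ι ⟨β, hβ⟩ ∈ AddSubgroup.zmultiples (ι x) := hx ▸ (hker ⟨β, hβ⟩).2 hpβ
  obtain ⟨k, hk⟩ := AddSubgroup.mem_zmultiples_iff.1 hmem
  have hι_nsmul : ∀ n : ℕ, ∃ y : archComp (∑ q ∈ Q, q),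
      (y : M) = (n + 1) • (x : M) ∧ ι y = (n + 1) • ι x := by
    intro n
    induction n with
    | zero => exact ⟨x, by simp, by simp⟩
    | succ n ih =>
      obtain ⟨y, hy, hy'⟩ := ih
      refine ⟨y + x, ?_, ?_⟩
      · rw [succ_nsmul, ← hy]; rfl
      · rw [succ_nsmul, ← hy', map_add]
  obtain ⟨y, hy, hy'⟩ := hι_nsmul k.natAbs
  obtain ⟨z, hz, hz'⟩ := hι_nsmul (k.natAbs + k).toNat
  obtain ⟨c, hc⟩ := hι' (⟨β, hβ⟩ + y) z (by
    rw [map_add, hy', hz', ← hk, ← natCast_zsmul, ← natCast_zsmul, ← add_zsmul]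
    congr 1
    omega)
  have hc' : β + (k.natAbs + 1) • (x : M) + c = ((k.natAbs + k).toNat + 1) • (x : M) + c := by
    rw [← hy, ← hz]
    exact congrArg Subtype.val hc
  obtain ⟨n, -, -, -, hcs, -⟩ := c.2
  obtain ⟨-, m, -, -, -, hsx⟩ := x.2
  obtain ⟨d, hd⟩ := hcs.trans (hsx.nsmul n)
  rw [← mul_nsmul] at hd
  refine ⟨k.natAbs + 1 + m * n, (k.natAbs + k).toNat + 1 + m * n, ?_⟩
  rw [add_nsmul _ (k.natAbs + 1), add_nsmul _ (_ + 1) (m * n), hd, ← add_assoc, ← add_assoc, hc',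
    add_assoc]

theorem InLowerCover.congr {p t c : M} (h : InLowerCover p t) (htc : algLE t c)
    (hct : algLE c t) : InLowerCover p c :=
  ⟨h.1.of_equiv htc hct, hct.trans_classLT h.2.1, fun ⟨u, hu, hcu, hup⟩ =>
    h.2.2 ⟨u, hu, htc.trans_classLT hcu, hup⟩⟩

theorem exists_inLowerCover_algLE {C : Finset M}
    (hC : ∀ t : M, IsPrimeElem t → ∃ c ∈ C, algLE c t ∧ algLE t c)
    {p q : M} (hq : IsPrimeElem q) (hqp : classLT q p) :
    ∃ t, InLowerCover p t ∧ algLE q t := by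
  classical
  let _ : Preorder M :=
    { le := algLE
      le_refl := algLE.refl
      le_trans := fun _ _ _ => algLE.trans }
  obtain ⟨c, hcC, hcq, hqc⟩ := hC q hq
  let D := C.filter fun t => IsPrimeElem t ∧ algLE q t ∧ classLT t p
  have hD : D.Nonempty := ⟨c, Finset.mem_filter.2
    ⟨hcC, hq.of_equiv hqc hcq, hqc, hcq.trans_classLT hqp⟩⟩
  obtain ⟨t, htD, ht⟩ := D.exists_maximal hD
  obtain ⟨-, htp, hqt, htp'⟩ := Finset.mem_filter.1 htD
  refine ⟨t, ⟨htp, htp', ?_⟩, hqt⟩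
  rintro ⟨u, hu, htu, hup⟩
  obtain ⟨d, hdC, hdu, hud⟩ := hC u hu
  have hdD : d ∈ D := Finset.mem_filter.2
    ⟨hdC, hu.of_equiv hud hdu, hqt.trans (htu.1.trans hud), hdu.trans_classLT hup⟩
  exact htu.2 (hud.trans (ht hdD (htu.1.trans hud)))

theorem exists_isLowerCoverReps {C : Finset M}
    (hC : ∀ t : M, IsPrimeElem t → ∃ c ∈ C, algLE c t ∧ algLE t c)
    (hinj : ∀ p ∈ C, ∀ q ∈ C, algLE p q → algLE q p → p = q) (p : M) :
    ∃ Q : Finset M, IsLowerCoverReps p Q := by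
  classical
  refine ⟨C.filter (InLowerCover p), fun q hq => (Finset.mem_filter.1 hq).2,
    fun q hq q' hq' => hinj q (Finset.mem_filter.1 hq).1 q' (Finset.mem_filter.1 hq').1,
    fun t ht => ?_⟩
  obtain ⟨c, hcC, hct, htc⟩ := hC t ht.1
  exact ⟨c, Finset.mem_filter.2 ⟨hcC, ht.congr htc hct⟩, hct, htc⟩

theorem add_mem_archComp {s x a : M} (hx : x ∈ archComp s) {n : ℕ} (ha : algLE a (n • s)) :
    a + x ∈ archComp s := by
  obtain ⟨k, m, hk, hm, hxs, hsx⟩ := hx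
  refine ⟨n + k, m, Nat.add_pos_right _ hk, hm, ?_, hsx.trans ((algLE_add_self a x).nsmul m)⟩
  rw [add_nsmul]
  exact ha.add hxs

/-- The word to be used in the relation `p = p + x` at a free prime `p`. -/
theorem exists_stabilizer_generator [AddMonoid.FG M] (hcon : IsConical M) (href : IsRefinement M)
    (hai : ∀ p : M, IsPrimeElem p → IsFreeElem p →
      (∃ q : M, IsPrimeElem q ∧ classLT q p) →
      ∀ Q : Finset M, IsLowerCoverReps p Q → AlmostIsoCondition M p Q)
    {p : M} (hp : IsPrimeElem p) (hf : IsFreeElem p) :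
    ∃ x : M, p + x = p ∧ ∀ β, p + β = p → ∃ n m : ℕ, β + n • x = m • x := by
  have hlt : ∀ {β q : M}, p + β = p → IsPrimeElem q → algLE q β → classLT q p := by
    intro β q hβ hq hqβ
    refine ⟨hqβ.trans ⟨p, by rw [add_comm, hβ]⟩, fun hpq => hf.not_isRegularElem ?_⟩
    have := (algLE.refl p).add (hpq.trans hqβ)
    rwa [hβ] at this
  by_cases hmin : ∃ q : M, IsPrimeElem q ∧ classLT q p
  · obtain ⟨C, -, hinj, hC⟩ := exists_prime_representatives M
    obtain ⟨Q, hQ⟩ := exists_isLowerCoverReps hC hinj p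
    have habs : ∑ q ∈ Q, q ∈ absorbed p :=
      sum_mem fun q hq => hp.add_algLE_self (hQ.1 q hq).2.1
    have hbound : ∀ β, (∀ q, IsPrimeElem q → algLE q β → classLT q p) →
        ∃ n : ℕ, algLE β (n • ∑ q ∈ Q, q) := by
      intro β
      have hβ : β ∈ AddSubmonoid.closure {p : M | IsPrimeElem p} := by
        rw [closure_setOf_isPrimeElem hcon href]; trivial
      induction hβ using AddSubmonoid.closure_induction with
      | mem β hβ =>
        intro h
        obtain ⟨t, ht, hβt⟩ := exists_inLowerCover_algLE hC hβ (h β hβ (algLE.refl β))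
        obtain ⟨q, hqQ, hqt, htq⟩ := hQ.2.2 t ht
        refine ⟨1, ?_⟩
        rw [one_nsmul]
        exact (hβt.trans htq).trans (algLE_sum_of_mem _ hqQ)
      | zero => exact fun _ => ⟨0, zero_algLE _⟩
      | add a b _ _ ha hb =>
        intro h
        obtain ⟨n, hn⟩ := ha fun q hq hqa => h q hq (hqa.trans (algLE_self_add _ _))
        obtain ⟨m, hm⟩ := hb fun q hq hqb => h q hq (hqb.trans (algLE_add_self _ _))
        exact ⟨n + m, by rw [add_nsmul]; exact hn.add hm⟩
    obtain ⟨x, hx, hpx, hgen⟩ := (hai p hp hf hmin Q hQ).exists_generator habs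
    refine ⟨x, hpx, fun β hβ => ?_⟩
    obtain ⟨n, hn⟩ := hbound β fun q => hlt hβ
    obtain ⟨k, m, hkm⟩ := hgen (β + x) (add_mem_archComp hx hn) (by rw [← add_assoc, hβ, hpx])
    exact ⟨k + 1, m, by rw [← hkm, succ_nsmul']; abel⟩
  · refine ⟨0, add_zero p, fun β hβ => ⟨0, 0, ?_⟩⟩
    rw [eq_zero_of_forall_isPrimeElem_not_algLE hcon href
      fun q hq hqβ => hmin ⟨q, hq, hlt hβ hq hqβ⟩]
    simp

end AlmostIso

section Words

variable {M : Type} [AddCommMonoid M] {V : Type} {N : Type} [AddCommMonoid N]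

theorem word_induction {P : (V →₀ ℕ) → Prop} (b : V →₀ ℕ) (zero : P 0)
    (single : ∀ v, P (Finsupp.single v 1)) (add : ∀ a b, P a → P b → P (a + b)) : P b := by
  induction b using Finsupp.induction_linear with
  | zero => exact zero
  | add a b ha hb => exact add a b ha hb
  | single v n =>
    induction n with
    | zero => simpa using zero
    | succ n ih => rw [Finsupp.single_add]; exact add _ _ ih (single v)

theorem exists_eq_single_add {b : V →₀ ℕ} {u : V} (hu : u ∈ b.support) :
    ∃ b', b = Finsupp.single u 1 + b' := by
  apply exists_add_of_le
  rw [Finsupp.single_le_iff]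
  exact Nat.one_le_iff_ne_zero.2 (Finsupp.mem_support_iff.1 hu)

theorem mem_support_add_left {a : V →₀ ℕ} (b : V →₀ ℕ) {u : V} (hu : u ∈ a.support) :
    u ∈ (a + b).support := by
  simp only [Finsupp.mem_support_iff, Finsupp.add_apply] at hu ⊢
  omega

theorem mem_support_add_right (a : V →₀ ℕ) {b : V →₀ ℕ} {u : V} (hu : u ∈ b.support) :
    u ∈ (a + b).support := by
  rw [add_comm]; exact mem_support_add_left a hu

theorem algLE_linearCombination (val : V → M) {b : V →₀ ℕ} {u : V} (hu : u ∈ b.support) :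
    algLE (val u) (Finsupp.linearCombination ℕ val b) := by
  obtain ⟨b', rfl⟩ := exists_eq_single_add hu
  exact ⟨Finsupp.linearCombination ℕ val b', by simp⟩

/-- All words with the same value as the one-letter word `v` are identified with it by `π`. -/
def IsDetermined (val : V → M) (π : (V →₀ ℕ) →+ N) (v : V) : Prop :=
  ∀ b, Finsupp.linearCombination ℕ val b = val v → π (Finsupp.single v 1) = π b

theorem exists_split {val : V → M} {π : (V →₀ ℕ) →+ N} (hcon : IsConical M)
    (href : IsRefinement M)
    (hsurj : Function.Surjective (Finsupp.linearCombination ℕ val)) (b : V →₀ ℕ) :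
    (∀ u ∈ b.support, IsDetermined val π u) →
    ∀ m n : M, Finsupp.linearCombination ℕ val b = m + n →
      ∃ b₁ b₂, Finsupp.linearCombination ℕ val b₁ = m ∧
        Finsupp.linearCombination ℕ val b₂ = n ∧ π b = π b₁ + π b₂ := by
  induction b using word_induction with
  | zero =>
    intro _ m n h
    obtain ⟨rfl, rfl⟩ := hcon m n (by rw [← h, map_zero])
    exact ⟨0, 0, by simp, by simp, by simp⟩
  | single v =>
    intro hv m n h
    obtain ⟨b₁, rfl⟩ := hsurj m
    obtain ⟨b₂, rfl⟩ := hsurj n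
    refine ⟨b₁, b₂, rfl, rfl, ?_⟩
    rw [hv v (by simp) (b₁ + b₂) (by rw [map_add, ← h]; simp), map_add]
  | add a b ha hb =>
    intro hab m n h
    rw [map_add] at h
    obtain ⟨w, x, y, z, hw, hy, rfl, rfl⟩ := href _ _ _ _ h
    obtain ⟨a₁, a₂, ha₁, ha₂, ha'⟩ := ha (fun u hu => hab u (mem_support_add_left b hu)) _ _ hw
    obtain ⟨b₁, b₂, hb₁, hb₂, hb'⟩ := hb (fun u hu => hab u (mem_support_add_right a hu)) _ _ hy
    refine ⟨a₁ + b₁, a₂ + b₂, by rw [map_add, ha₁, hb₁], by rw [map_add, ha₂, hb₂], ?_⟩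
    simp only [map_add, ha', hb']
    abel

theorem map_eq_of_forall_isDetermined {val : V → M} {π : (V →₀ ℕ) →+ N} (hcon : IsConical M)
    (href : IsRefinement M)
    (hprime : ∀ v, IsPrimeElem (val v))
    (hsurj : Function.Surjective (Finsupp.linearCombination ℕ val)) {D : V → Prop}
    (hD : ∀ u u', algLE (val u) (val u') → D u' → D u) (hH : ∀ u, D u → IsDetermined val π u)
    (a : V →₀ ℕ) : (∀ u ∈ a.support, D u) → ∀ b,
      Finsupp.linearCombination ℕ val a = Finsupp.linearCombination ℕ val b → π a = π b := by
  induction a using word_induction with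
  | zero =>
    intro _ b hb
    have : b = 0 := by
      by_contra hne
      obtain ⟨u, hu⟩ := Finsupp.support_nonempty_iff.2 hne
      have := algLE_linearCombination val hu
      rw [← hb, map_zero] at this
      exact (hprime u).not_algLE_zero this
    rw [this]
  | single v =>
    intro hv b hb
    exact hH v (hv v (by simp)) b (by rw [← hb]; simp)
  | add f g hf hg =>
    intro hfg b hb
    have hDb : ∀ u ∈ b.support, D u := by
      intro u hu
      have := algLE_linearCombination val hu
      rw [← hb] at this
      obtain ⟨u', hu', h⟩ := (hprime u).exists_algLE_of_algLE_linearCombination this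
      exact hD u u' h (hfg u' hu')
    obtain ⟨b₁, b₂, hb₁, hb₂, hπ⟩ := exists_split hcon href hsurj b
      (fun u hu => hH u (hDb u hu)) _ _ (hb.symm.trans (map_add _ _ _))
    rw [hπ, map_add, hf (fun u hu => hfg u (mem_support_add_left g hu)) b₁ hb₁.symm,
      hg (fun u hu => hfg u (mem_support_add_right f hu)) b₂ hb₂.symm]

theorem map_eq_of_linearCombination_eq [AddMonoid.FG M] {val : V → M} {π : (V →₀ ℕ) →+ N}
    (hcon : IsConical M)
    (href : IsRefinement M) (hprime : ∀ v, IsPrimeElem (val v))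
    (hsurj : Function.Surjective (Finsupp.linearCombination ℕ val))
    (hfree : ∀ v, IsFreeElem (val v) →
      (∀ u, algLE (val u) (val v) → algLE (val v) (val u) → u = v) ∧
      ∃ X, π (Finsupp.single v 1) = π (Finsupp.single v 1) + π X ∧
        val v + Finsupp.linearCombination ℕ val X = val v ∧
        ∀ β, val v + β = val v → ∃ n m : ℕ,
          β + n • Finsupp.linearCombination ℕ val X = m • Finsupp.linearCombination ℕ val X)
    (hreg : ∀ v, IsRegularElem (val v) → IsDetermined val π v) (a b : V →₀ ℕ)
    (hab : Finsupp.linearCombination ℕ val a = Finsupp.linearCombination ℕ val b) :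
    π a = π b := by
  refine map_eq_of_forall_isDetermined hcon href hprime hsurj (D := fun _ => True)
    (fun _ _ _ _ => trivial) (fun v _ => ?_) a (fun _ _ => trivial) b hab
  refine (InvImage.wf val wellFounded_classLT).induction
    (C := fun v => IsDetermined val π v) v fun v ih => ?_
  rcases (hprime v).isFreeElem_or_isRegularElem href with hv | hv
  · obtain ⟨huniq, X, hX, hvX, hgen⟩ := hfree v hv
    intro b hb
    obtain ⟨u, hu, hvu⟩ := (hprime v).exists_algLE_of_algLE_linearCombination
      (val := val) (b := b) (by rw [hb]; exact algLE.refl _)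
    have huv := algLE_linearCombination val hu
    rw [hb] at huv
    obtain rfl := huniq u huv hvu
    obtain ⟨b', rfl⟩ := exists_eq_single_add hu
    have hb' : val u + Finsupp.linearCombination ℕ val b' = val u := by simpa using hb
    obtain ⟨n, m, hnm⟩ := hgen _ hb'
    have hvk : ∀ k : ℕ, val u + k • Finsupp.linearCombination ℕ val X = val u := by
      intro k
      induction k with
      | zero => simp
      | succ k ih => rw [succ_nsmul, ← add_assoc, ih, hvX]
    have hπk : ∀ k : ℕ, π (Finsupp.single u 1) + k • π X = π (Finsupp.single u 1) := by
      intro k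
      induction k with
      | zero => simp
      | succ k ih => rw [succ_nsmul, ← add_assoc, ih, ← hX]
    have key : π (b' + n • X) = π (m • X) := by
      refine map_eq_of_forall_isDetermined hcon href hprime hsurj
        (D := fun w => classLT (val w) (val u)) (fun _ _ h h' => h.trans_classLT h') ih _ ?_ _
        (by simpa using hnm)
      intro w hw
      have hw' := algLE_linearCombination val hw
      rw [map_add, map_nsmul, hnm] at hw'
      refine ⟨hw'.trans ⟨val u, by rw [add_comm, hvk]⟩, fun h => hv.not_isRegularElem ?_⟩
      have := (algLE.refl (val u)).add (h.trans hw')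
      rwa [hvk] at this
    rw [map_add, map_nsmul, map_nsmul] at key
    rw [map_add, ← hπk n, add_right_comm, add_assoc, key, hπk, hπk]
  · exact hreg v hv

/-- If the words of value `e` can all be absorbed, then words are determined by their values. -/
theorem map_eq_of_regular_class {val : V → M} {π : (V →₀ ℕ) →+ N} {γ : ℕ → M} {e : M}
    (hinv : ∀ k, ∃ i, γ k + γ i = e) {v : ℕ → Bool → V} (hv : ∀ k b, val (v k b) = γ k)
    {T : ℕ → N} (hT : ∀ k, algLE (π (Finsupp.single (v 0 false) 1)) (T k))
    (hT' : ∀ k, algLE (π (Finsupp.single (v k true) 1)) (T k))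
    (hT'' : ∀ k, algLE (π (Finsupp.single (v (k + 1) false) 1)) (T k))
    {w : ℕ → V →₀ ℕ} (hw : ∀ x, Finsupp.linearCombination ℕ val x = e → ∃ k, w k = x)
    (hfalse : ∀ k, π (Finsupp.single (v k false) 1) = π (Finsupp.single (v k false) 1) + T k)
    (htrue : ∀ k, π (Finsupp.single (v k true) 1) =
      π (Finsupp.single (v k true) 1) + (T k + π (w k)))
    {a b : V →₀ ℕ} {i : ℕ} (ha : Finsupp.linearCombination ℕ val a = γ i)
    (hb : Finsupp.linearCombination ℕ val b = γ i)
    (ha' : ∃ k β, v k β ∈ a.support) (hb' : ∃ k β, v k β ∈ b.support) : π a = π b := by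
  obtain ⟨r, hr⟩ : algLE (π (Finsupp.single (v 0 false) 1) + π (Finsupp.single (v 0 false) 1))
      (π (Finsupp.single (v 0 false) 1)) := by
    have := (algLE.refl (π (Finsupp.single (v 0 false) 1))).add (hT 0)
    rwa [← hfalse] at this
  have hle : ∀ k, algLE (π (Finsupp.single (v k false) 1)) (π (Finsupp.single (v 0 false) 1)) := by
    intro k
    induction k with
    | zero => exact algLE.refl _
    | succ k ih =>
      refine (hT'' k).trans (algLE.trans ?_ ih)
      rw [hfalse k]; exact algLE_add_self _ _
  have hle' : ∀ k, algLE (π (Finsupp.single (v k true) 1)) (π (Finsupp.single (v 0 false) 1)) := by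
    intro k
    refine (hT' k).trans (algLE.trans ?_ (hle k))
    rw [hfalse k]; exact algLE_add_self _ _
  have hge : ∀ k β, algLE (π (Finsupp.single (v 0 false) 1)) (π (Finsupp.single (v k β) 1)) := by
    rintro k (_ | _)
    · rw [hfalse k]; exact (hT k).trans (algLE_add_self _ _)
    · rw [htrue k]
      exact (hT k).trans ((algLE_self_add _ _).trans (algLE_add_self _ _))
  generalize hz : π (Finsupp.single (v 0 false) 1) = z at *
  have hcancel : ∀ y s, algLE y z → y = y + s → z + r + s = z + r := by
    rintro y s ⟨y', hy'⟩ hys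
    calc z + r + s = (y + s) + y' + r := by rw [hy']; abel
      _ = z + r := by rw [← hys, ← hy']
  have hsmall : ∀ x, Finsupp.linearCombination ℕ val x = e → z + r + π x = z + r := by
    intro x hx
    obtain ⟨k, rfl⟩ := hw x hx
    have h := hcancel _ _ (hle' k) (htrue k)
    rwa [← add_assoc, hcancel _ _ (hle k) (hfalse k)] at h
  have habs : ∀ x : V →₀ ℕ, (∃ k β, v k β ∈ x.support) → π x + (z + r) = π x := by
    rintro x ⟨k, β, hx⟩
    obtain ⟨x', rfl⟩ := exists_eq_single_add hx
    obtain ⟨s, hs⟩ := hge k β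
    rw [map_add, hs]
    calc z + s + π x' + (z + r) = (z + z + r) + s + π x' := by abel
      _ = z + s + π x' := by rw [← hr]
  obtain ⟨j, hj⟩ := hinv i
  have hval : ∀ x, Finsupp.linearCombination ℕ val x = γ i →
      z + r + (π x + π (Finsupp.single (v j false) 1)) = z + r := by
    intro x hx
    rw [← map_add]
    exact hsmall _ (by rw [map_add, hx]; simp [hv, hj])
  calc π a = π a + (z + r + (π b + π (Finsupp.single (v j false) 1))) := by
        rw [hval b hb, habs a ha']
    _ = π b + (z + r + (π a + π (Finsupp.single (v j false) 1))) := by abel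
    _ = π b := by rw [hval a ha, habs b hb']

end Words

section Graph

variable {M : Type} [AddCommMonoid M] {V : Type}

/-- The graph with `R v w` edges from `v` to `w`. -/
def wordGraph [Countable V] (R : V → V →₀ ℕ) : RowFiniteGraph where
  V := V
  E := Σ v : V, Σ w : (R v).support, Fin (R v w)
  countableV := inferInstance
  countableE := inferInstance
  s e := e.1
  r e := e.2.1
  rowFinite v := (Set.finite_range (Sigma.mk v)).subset <| by
    rintro ⟨v', e⟩ rfl
    exact ⟨e, rfl⟩

theorem sum_sigma_single_fst (R : V → V →₀ ℕ) (v : V)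
    (hfin : {e : Σ v : V, Σ w : (R v).support, Fin (R v w) | e.1 = v}.Finite) :
    ∑ e ∈ hfin.toFinset, Finsupp.single (e.2.1 : V) 1 = R v := by
  classical
  have : hfin.toFinset = (Finset.univ : Finset (Σ w : (R v).support, Fin (R v w))).map
      (Function.Embedding.sigmaMk (β := fun v => Σ w : (R v).support, Fin (R v w)) v) := by
    ext e
    simp only [Set.Finite.mem_toFinset, Finset.mem_map, Finset.mem_univ, true_and]
    constructor
    · obtain ⟨v', e⟩ := e
      rintro rfl
      exact ⟨e, rfl⟩
    · rintro ⟨e, rfl⟩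
      rfl
  rw [this, Finset.sum_map]
  change ∑ x : Σ w : (R v).support, Fin (R v w), Finsupp.single (x.1 : V) 1 = R v
  rw [Fintype.sum_sigma]
  simp only [Finset.sum_const, Finset.card_univ, Fintype.card_fin, Finsupp.smul_single, smul_eq_mul,
    mul_one]
  rw [Finset.sum_coe_sort (R v).support fun w => Finsupp.single w (R v w)]
  exact Finsupp.sum_single (R v)

theorem graphRel_wordGraph [Countable V] {R : V → V →₀ ℕ} (hR : ∀ v, R v ≠ 0) (x y : V →₀ ℕ) :
    graphRel (wordGraph R) x y ↔ ∃ v, x = Finsupp.single v 1 ∧ y = R v := by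
  have hsum (v : V) := sum_sigma_single_fst R v ((wordGraph R).rowFinite v)
  constructor
  · rintro ⟨v, -, hx, hy⟩
    exact ⟨v, hx, hy.trans (hsum v)⟩
  · rintro ⟨v, hx, hy⟩
    obtain ⟨w, hw⟩ := Finsupp.support_nonempty_iff.2 (hR v)
    exact ⟨v, ⟨⟨v, ⟨w, hw⟩, ⟨0, Nat.pos_of_ne_zero (Finsupp.mem_support_iff.1 hw)⟩⟩, rfl⟩, hx,
      hy.trans (hsum v).symm⟩

theorem exists_graphMonoid_equiv [Countable V] {val : V → M} {R : V → V →₀ ℕ} (hR₀ : ∀ v, R v ≠ 0)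
    (hR : ∀ v, Finsupp.linearCombination ℕ val (R v) = val v)
    (hsurj : Function.Surjective (Finsupp.linearCombination ℕ val))
    (hinj : ∀ {N : Type} [AddCommMonoid N] (π : (V →₀ ℕ) →+ N),
      (∀ v, π (Finsupp.single v 1) = π (R v)) → ∀ a b,
        Finsupp.linearCombination ℕ val a = Finsupp.linearCombination ℕ val b → π a = π b) :
    ∃ G : RowFiniteGraph, Nonempty (M ≃+ graphMonoid G) := by
  let ev : (V →₀ ℕ) →+ M := (Finsupp.linearCombination ℕ val).toAddMonoidHom
  have hker : addConGen (graphRel (wordGraph R)) = AddCon.ker ev := by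
    apply le_antisymm
    · refine AddCon.addConGen_le.2 fun x y h => ?_
      obtain ⟨v, rfl, rfl⟩ := (graphRel_wordGraph hR₀ x y).1 h
      change Finsupp.linearCombination ℕ val _ = Finsupp.linearCombination ℕ val _
      rw [hR]; simp
    · intro a b hab
      refine (AddCon.eq _).1 (hinj (addConGen (graphRel (wordGraph R))).mk' (fun v => ?_) a b hab)
      exact (AddCon.eq _).2 (AddConGen.Rel.of _ _ ((graphRel_wordGraph hR₀ _ _).2 ⟨v, rfl, rfl⟩))
  exact ⟨wordGraph R, ⟨((AddCon.congr (AddEquiv.refl (V →₀ ℕ)) hker).trans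
    (AddCon.quotientKerEquivOfSurjective ev hsurj)).symm⟩⟩

theorem IsRegularElem.exists_enumeration [Countable M] {p : M} (hp : IsRegularElem p) :
    ∃ (γ : ℕ → M) (e : M), (∀ k, algLE (γ k) p ∧ algLE p (γ k)) ∧
      (∀ x, algLE x p → algLE p x → ∃ k, γ k = x) ∧ (∀ k, γ k + e = γ k) ∧
      ∀ k, ∃ i, γ k + γ i = e := by
  obtain ⟨z, hz⟩ := id hp
  have : Nonempty {x : M // algLE x p ∧ algLE p x} := ⟨⟨p, algLE.refl p, algLE.refl p⟩⟩
  obtain ⟨g, hg⟩ := exists_surjective_nat {x : M // algLE x p ∧ algLE p x}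
  have hmem : ∀ x, algLE x p → algLE p x → ∃ k, (g k : M) = x := fun x h h' => by
    obtain ⟨k, hk⟩ := hg ⟨x, h, h'⟩
    exact ⟨k, by rw [hk]⟩
  have hpe : p + (p + z) = p := by rw [← add_assoc, ← hz]
  have hee : p + z + (p + z) = p + z := by
    calc p + z + (p + z) = p + (p + z) + z := by abel
      _ = p + z := by rw [hpe]
  refine ⟨fun k => g k, p + z, fun k => (g k).2, hmem, fun k => ?_, fun k => ?_⟩
  · obtain ⟨d, hd⟩ := (g k).2.2
    simp only [hd]
    rw [add_right_comm, hpe]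
  · obtain ⟨w, hw⟩ := (g k).2.1.trans (algLE_self_add p z)
    have hwp : algLE (w + (p + z)) p := by
      refine algLE.trans (algLE.add ?_ ?_) hp
      · refine algLE.trans ?_ ⟨p, (hpe.symm.trans (add_comm _ _))⟩
        rw [hw]; exact algLE_add_self _ _
      · exact ⟨p, (hpe.symm.trans (add_comm _ _))⟩
    obtain ⟨i, hi⟩ := hmem (w + (p + z)) hwp ((algLE_self_add p z).trans (algLE_add_self _ _))
    exact ⟨i, by simp only [hi]; rw [← add_assoc, ← hw, hee]⟩

end Graph

/-- **sufficiency.** Let `M` be a finitely generated conical refinement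
monoid such that for every free prime `p` of `M` which is not minimal in the poset of
primes, and every set `Q` of representatives of the lower cover of `p̄`, the unique
group homomorphism `G(φ_p) : G(M_{J_p}) → G'_p` induced by `φ_p` on a Grothendieck
group of `M_{J_p}` is surjective with kernel the cyclic subgroup generated by `ι x`
for some `x ∈ M_{J_p}`. Then `M` is isomorphic to the graph monoid of a countable
row-finite directed graph. -/
theorem isGraphMonoid_of_almostIso (M : Type) [AddCommMonoid M] [AddMonoid.FG M]
    (hcon : IsConical M) (href : IsRefinement M)
    (hai : ∀ p : M, IsPrimeElem p → IsFreeElem p →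
      (∃ q : M, IsPrimeElem q ∧ classLT q p) →
      ∀ Q : Finset M, IsLowerCoverReps p Q → AlmostIsoCondition M p Q) :
    ∃ G : RowFiniteGraph, Nonempty (M ≃+ graphMonoid G) := by
  classical
  have : Countable M := by
    obtain ⟨S, hS⟩ := exists_surjective_linearCombination M
    exact hS.countable
  obtain ⟨C, hCprime, hCinj, hC⟩ := exists_prime_representatives M
  let F := {p : M // p ∈ C ∧ IsFreeElem p}
  let P := {p : M // p ∈ C ∧ IsRegularElem p}
  let V := F ⊕ (P × ℕ × Bool)
  choose x hpx hx using fun p : F =>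
    exists_stabilizer_generator hcon href hai (hCprime p p.2.1) p.2.2
  choose γ e hγ hγsurj hγadd hγinv using fun p : P => p.2.2.exists_enumeration
  let val : V → M := Sum.elim (fun p => p.1) (fun q => γ q.1 q.2.1)
  have hprime : ∀ v, IsPrimeElem (val v) := by
    rintro (p | ⟨p, k, b⟩)
    · exact hCprime p p.2.1
    · exact (hCprime p p.2.1).of_equiv (hγ p k).2 (hγ p k).1
  have hsurj : Function.Surjective (Finsupp.linearCombination ℕ val) := by
    rw [← LinearMap.range_eq_top]
    apply Submodule.toAddSubmonoid_injective
    refine eq_top_of_isPrimeElem_mem hcon href _ fun y hy ih => ?_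
    obtain ⟨c, hcC, hcy, hyc⟩ := hC y hy
    rcases (hCprime c hcC).isFreeElem_or_isRegularElem href with hc | hc
    · obtain ⟨α, rfl⟩ := hcy
      refine add_mem ⟨Finsupp.single (Sum.inl ⟨c, hcC, hc⟩) 1, by simp [val]⟩ (ih α ?_)
      exact ⟨algLE_add_self _ _, fun h => hc.not_isRegularElem
        (((algLE.refl c).add ((algLE_self_add c α).trans h)).trans hyc)⟩
    · obtain ⟨k, hk⟩ := hγsurj ⟨c, hcC, hc⟩ y hyc hcy
      exact ⟨Finsupp.single (Sum.inr (⟨c, hcC, hc⟩, k, false)) 1, by simp [val, hk]⟩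
  choose X hX using fun p : F => hsurj (x p)
  have hW : ∀ p : P, ∃ w : ℕ → V →₀ ℕ, ∀ y,
      Finsupp.linearCombination ℕ val y = e p ↔ ∃ k, w k = y := by
    intro p
    have : Nonempty {y : V →₀ ℕ // Finsupp.linearCombination ℕ val y = e p} := by
      obtain ⟨y, hy⟩ := hsurj (e p)
      exact ⟨⟨y, hy⟩⟩
    obtain ⟨g, hg⟩ := exists_surjective_nat {y : V →₀ ℕ // Finsupp.linearCombination ℕ val y = e p}
    refine ⟨fun k => g k, fun y => ⟨fun hy => ?_, ?_⟩⟩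
    · obtain ⟨k, hk⟩ := hg ⟨y, hy⟩
      exact ⟨k, congrArg Subtype.val hk⟩
    · rintro ⟨k, rfl⟩
      exact (g k).2
  choose w hw using hW
  have hcorr : ∀ (p : P) (k : ℕ), ∃ i, γ p 0 + γ p k + γ p (k + 1) + γ p i = e p := by
    intro p k
    obtain ⟨l, hl⟩ := hγsurj p (γ p 0 + γ p k + γ p (k + 1))
      (((((hγ p 0).1.add (hγ p k).1).trans p.2.2).add (hγ p (k + 1)).1).trans p.2.2)
      ((hγ p (k + 1)).2.trans (algLE_add_self _ _))
    rw [← hl]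
    exact hγinv p l
  choose c hc using hcorr
  let v (p : P) (k : ℕ) (b : Bool) : V := Sum.inr (p, k, b)
  let t (p : P) (k : ℕ) : V →₀ ℕ := Finsupp.single (v p 0 false) 1 + Finsupp.single (v p k true) 1 +
    Finsupp.single (v p (k + 1) false) 1 + Finsupp.single (v p (c p k) false) 1
  have ht : ∀ p k, Finsupp.linearCombination ℕ val (t p k) = e p := by
    intro p k
    simp [t, v, val, hc]
  let R : V → V →₀ ℕ := fun u => Finsupp.single u 1 +
    Sum.elim X (fun q => t q.1 q.2.1 + bif q.2.2 then w q.1 q.2.1 else 0) u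
  refine exists_graphMonoid_equiv (val := val) (R := R) ?_ ?_ hsurj ?_
  · intro u hu
    have := DFunLike.congr_fun hu u
    simp [R] at this
  · rintro (p | ⟨p, k, _ | _⟩)
    · simp [R, val, hX, hpx]
    · simp [R, val, ht, hγadd]
    · have := (hw p (w p k)).2 ⟨k, rfl⟩
      simp [R, val, ht, hγadd, this, ← add_assoc]
  · intro N _ π hπ
    refine map_eq_of_linearCombination_eq hcon href hprime hsurj ?_ ?_
    · rintro (p | ⟨p, k, b⟩) hfree
      · refine ⟨?_, X p, ?_, ?_, ?_⟩
        · rintro (q | ⟨q, k, b⟩) h h'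
          · exact congrArg Sum.inl (Subtype.ext (hCinj q q.2.1 p p.2.1 h h'))
          · have := hCinj q q.2.1 p p.2.1 ((hγ q k).2.trans h) (h'.trans (hγ q k).1)
            exact absurd (this ▸ q.2.2) p.2.2.not_isRegularElem
        · exact (hπ (Sum.inl p)).trans (map_add _ _ _)
        · rw [hX]; exact hpx p
        · rw [hX]; exact hx p
      · refine absurd ?_ hfree.not_isRegularElem
        exact (((hγ p k).1.add (hγ p k).1).trans p.2.2).trans (hγ p k).2
    · rintro (p | ⟨p, k, b⟩) hreg
      · exact absurd hreg p.2.2.not_isRegularElem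
      · intro y hy
        have hsupp : ∃ k b, v p k b ∈ y.support := by
          obtain ⟨u, hu, hle⟩ := (hCprime p p.2.1).exists_algLE_of_algLE_linearCombination
            (val := val) (b := y) (by rw [hy]; exact (hγ p k).2)
          have hge := (algLE_linearCombination val hu).trans (by rw [hy]; exact (hγ p k).1)
          obtain q | ⟨q, l, d⟩ := u
          · exact absurd ((hCinj q q.2.1 p p.2.1 hge hle).symm ▸ p.2.2 : IsRegularElem q.1)
              q.2.2.not_isRegularElem
          · have : q = p := Subtype.ext (hCinj q q.2.1 p p.2.1 ((hγ q l).2.trans hge)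
              (hle.trans (hγ q l).1))
            subst this
            exact ⟨l, d, hu⟩
        refine map_eq_of_regular_class (val := val) (γ := γ p) (e := e p) (v := v p) (w := w p)
          (T := fun k => π (t p k)) (i := k) (hγinv p) (fun _ _ => rfl) (fun l => ?_) (fun l => ?_)
          (fun l => ?_) (fun y => (hw p y).1) (fun l => ?_) (fun l => ?_) (by simp [val]) hy
          ⟨k, b, by simp [v]⟩ hsupp
        · simp only [t, map_add, add_assoc]
          exact algLE_self_add _ _
        · simp only [t, map_add]
          exact (algLE_add_self _ _).trans ((algLE_self_add _ _).trans (algLE_self_add _ _))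
        · simp only [t, map_add]
          exact (algLE_add_self _ _).trans (algLE_self_add _ _)
        · refine (hπ (v p l false)).trans ?_
          simp [R, v]
        · refine (hπ (v p l true)).trans ?_
          simp [R, v]

end ArPardo
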